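/- arXiv:2605.14848 — 2 statements merged into one kernel-verified Lean document; each statement's English description precedes it below -/
import Mathlib

section
/- Let m, k₁, k₂ be integers with m ≥ 9 and 2 ≤ k₁ < k₁ + 1 < k₂ ≤ ⌊(m−1)/2⌋, and let f, g be the characteristic-type functions defined from the weight classes A, B, C, D. Then Re((f−g)^∧(0)) = 3^m − (3/2)·(Σ_{j=1}^{k₁} 2^j·C(m,j) + 2^{k₂}·C(m,k₂)), and for every w ∈ F₃^m with Hamming weight wt(w) = i ≥ 1, Re((f−g)^∧(w)) = −(3/2)·(Ψ_{k₂}(i,m) + Ψ_{k₁}(i,m) − Ψ_{k₂−1}(i,m)) + 3/2. -/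
open Finset

/-- `ζ₃ = e^{2πi/3}`, a primitive complex cube root of unity. -/
noncomputable def zeta3 : ℂ := Complex.exp (2 * Real.pi * Complex.I / 3)

/-- `ζ₃^a` for `a ∈ F₃`. -/
noncomputable def chi (a : ZMod 3) : ℂ := zeta3 ^ a.val

/-- Standard inner product on `F₃^m`. -/
def dotp {m : ℕ} (w x : Fin m → ZMod 3) : ZMod 3 := ∑ i, w i * x i

/-- Walsh transform of `F : F₃^m → F₃`. -/
noncomputable def walsh {m : ℕ} (F : (Fin m → ZMod 3) → ZMod 3)
    (w : Fin m → ZMod 3) : ℂ :=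
  ∑ x : Fin m → ZMod 3, chi (F x - dotp w x)

/-- Ternary Krawtchouk polynomial `K_t(x,m)`. -/
def Kraw (t x m : ℕ) : ℤ :=
  ∑ j ∈ Finset.range (t + 1),
    (-1 : ℤ) ^ j * 2 ^ (t - j) * (x.choose j : ℤ) * ((m - x).choose (t - j) : ℤ)

/-- Lloyd polynomial `Ψ_k(x,m) = Σ_{t=0}^k K_t(x,m)`. -/
def Lloyd (k x m : ℕ) : ℤ := ∑ t ∈ Finset.range (k + 1), Kraw t x m

/-- `f(x) = 1` iff `x ∈ A ∪ C ∪ D`, i.e. `1 ≤ wt(x) ≤ k₂` and `wt(x) ≠ k₁`. -/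
def ffun (m k₁ k₂ : ℕ) (x : Fin m → ZMod 3) : ZMod 3 :=
  if 1 ≤ hammingNorm x ∧ hammingNorm x ≤ k₂ ∧ hammingNorm x ≠ k₁ then 1 else 0

/-- `g(x) = 1` on `B ∪ C` (i.e. `k₁ ≤ wt(x) ≤ k₂ - 1`), `g(x) = -1` on `D` (`wt(x) = k₂`). -/
def gfun (m k₁ k₂ : ℕ) (x : Fin m → ZMod 3) : ZMod 3 :=
  if k₁ ≤ hammingNorm x ∧ hammingNorm x ≤ k₂ - 1 then 1
  else if hammingNorm x = k₂ then -1 else 0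

/-- The codeword `c(u,r,v)` of `C_{f,g}` for the specific `f = ffun`, `g = gfun`. -/
def cw (m k₁ k₂ : ℕ) (u r : ZMod 3) (v : Fin m → ZMod 3) :
    {x : Fin m → ZMod 3 // x ≠ 0} → ZMod 3 :=
  fun x => u * ffun m k₁ k₂ x.1 + r * gfun m k₁ k₂ x.1 + dotp v x.1

/-- Hamming weight of the codeword `c(u,r,v)`. -/
def cwt (m k₁ k₂ : ℕ) (u r : ZMod 3) (v : Fin m → ZMod 3) : ℕ :=
  (Finset.univ.filter
    (fun x : {x : Fin m → ZMod 3 // x ≠ 0} => cw m k₁ k₂ u r v x ≠ 0)).card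

open Polynomial in
/-- The generating function of the Krawtchouk numbers `Kraw t i (i + n)`. -/
theorem coeff_one_sub_X_pow_mul (t i n : ℕ) :
    ((1 - X : ℤ[X]) ^ i * (1 + 2 * X) ^ n).coeff t = Kraw t i (i + n) := by
  have h1 (j : ℕ) : ((1 - X : ℤ[X]) ^ i).coeff j = (-1) ^ j * (i.choose j : ℤ) := by
    have h : (1 - X : ℤ[X]) ^ i = ((1 + X : ℤ[X]) ^ i).comp (C (-1) * X) := by
      simp [sub_eq_add_neg]
    rw [h, comp_C_mul_X_coeff, coeff_one_add_X_pow, mul_comm]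
  have h2 (j : ℕ) : ((1 + 2 * X : ℤ[X]) ^ n).coeff j = 2 ^ j * (n.choose j : ℤ) := by
    have h : (1 + 2 * X : ℤ[X]) ^ n = ((1 + X : ℤ[X]) ^ n).comp (C 2 * X) := by
      simp
    rw [h, comp_C_mul_X_coeff, coeff_one_add_X_pow, mul_comm]
  rw [coeff_mul, Finset.Nat.sum_antidiagonal_eq_sum_range_succ_mk, Kraw]
  refine Finset.sum_congr rfl fun j _ => ?_
  rw [h1, h2, Nat.add_sub_cancel_left]
  ring

open Polynomial in
theorem sum_range_Kraw {i m : ℕ} (him : i ≤ m) :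
    ∑ t ∈ Finset.range (m + 1), Kraw t i m = if i = 0 then 3 ^ m else 0 := by
  obtain ⟨n, rfl⟩ := Nat.exists_eq_add_of_le him
  have hdeg : ((1 - X : ℤ[X]) ^ i * (1 + 2 * X) ^ n).natDegree < i + n + 1 := by
    have h1 : (1 - X : ℤ[X]).natDegree ≤ 1 := by compute_degree
    have h2 : (1 + 2 * X : ℤ[X]).natDegree ≤ 1 := by compute_degree
    refine Nat.lt_succ_of_le (natDegree_mul_le.trans (add_le_add ?_ ?_))
    · simpa using natDegree_pow_le_of_le i h1
    · simpa using natDegree_pow_le_of_le n h2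
  have h := eval_eq_sum_range' hdeg 1
  simp only [coeff_one_sub_X_pow_mul, one_pow, mul_one] at h
  rw [← h]
  rcases eq_or_ne i 0 with rfl | hi
  · norm_num
  · simp [hi]

theorem Kraw_zero_middle (t m : ℕ) : Kraw t 0 m = 2 ^ t * (m.choose t : ℤ) := by
  rw [Kraw, Finset.sum_eq_single 0]
  · simp
  · intro j _ hj
    simp [Nat.choose_eq_zero_of_lt (Nat.pos_of_ne_zero hj)]
  · simp

theorem Kraw_zero_left (i m : ℕ) : Kraw 0 i m = 1 := by
  simp [Kraw]

theorem isPrimitiveRoot_zeta3 : IsPrimitiveRoot zeta3 3 := by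
  simpa [zeta3] using Complex.isPrimitiveRoot_exp 3 (by norm_num)

theorem chi_add (a b : ZMod 3) : chi (a + b) = chi a * chi b := by
  simp only [chi]
  rw [← pow_add, ZMod.val_add, ← pow_eq_pow_mod _ isPrimitiveRoot_zeta3.pow_eq_one]

theorem chi_zero : chi 0 = 1 := by simp [chi]

theorem chi_sum {ι : Type*} (s : Finset ι) (a : ι → ZMod 3) :
    chi (∑ i ∈ s, a i) = ∏ i ∈ s, chi (a i) := by
  classical
  induction s using Finset.induction_on with
  | empty => simp [chi_zero]
  | insert i s hi ih => rw [Finset.sum_insert hi, Finset.prod_insert hi, chi_add, ih]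

theorem chi_one_add_chi_two : chi 1 + chi 2 = -1 := by
  have h := isPrimitiveRoot_zeta3.geom_sum_eq_zero (by norm_num)
  simp only [Finset.sum_range_succ, Finset.sum_range_zero] at h
  have h1 : (1 : ZMod 3).val = 1 := rfl
  have h2 : (2 : ZMod 3).val = 2 := rfl
  rw [chi, chi, h1, h2]
  linear_combination h

theorem chi_one_re : (chi 1).re = -1 / 2 := by
  have h1 : (1 : ZMod 3).val = 1 := rfl
  have h : 2 * Real.pi / 3 = Real.pi - Real.pi / 3 := by ring
  have h' : zeta3 = Complex.exp ((2 * Real.pi / 3 : ℝ) * Complex.I) := by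
    rw [zeta3]; push_cast; ring_nf
  rw [chi, h1, pow_one, h', Complex.exp_ofReal_mul_I_re, h, Real.cos_pi_sub,
    Real.cos_pi_div_three]
  norm_num

theorem chi_re (a : ZMod 3) : (chi a).re = 1 - if a = 0 then 0 else 3 / 2 := by
  have h := congrArg Complex.re chi_one_add_chi_two
  have h1 := chi_one_re
  simp only [Complex.add_re, Complex.neg_re, Complex.one_re] at h
  obtain rfl | rfl | rfl : a = 0 ∨ a = 1 ∨ a = 2 := by revert a; decide
  · simp [chi_zero]
  · rw [h1, if_neg (by decide)]; norm_num
  · rw [if_neg (by decide)]; linarith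

open Polynomial in
theorem sum_chi_mul_X_pow (b : ZMod 3) :
    ∑ a : ZMod 3, C (chi (-(b * a))) * X ^ (if a ≠ 0 then 1 else 0)
      = if b ≠ 0 then (1 - X : ℂ[X]) else 1 + 2 * X := by
  have huniv : (Finset.univ : Finset (ZMod 3)) = {0, 1, 2} := by decide
  have hC : C (chi 1) + C (chi 2) = (-1 : ℂ[X]) := by
    rw [← C_add, chi_one_add_chi_two]; simp
  have h01 : (0 : ZMod 3) ∉ ({1, 2} : Finset (ZMod 3)) := by decide
  have h12 : (1 : ZMod 3) ∉ ({2} : Finset (ZMod 3)) := by decide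
  have e1 : (1 : ZMod 3) ≠ 0 := by decide
  have e2 : (2 : ZMod 3) ≠ 0 := by decide
  rw [huniv, Finset.sum_insert h01, Finset.sum_insert h12, Finset.sum_singleton,
    if_neg (by simp), if_pos e1, if_pos e2]
  obtain rfl | rfl | rfl : b = 0 ∨ b = 1 ∨ b = 2 := by revert b; decide
  · simp only [zero_mul, neg_zero, chi_zero]
    simp
    ring
  · have h1 : (-(1 * 1) : ZMod 3) = 2 := by decide
    have h2 : (-(1 * 2) : ZMod 3) = 1 := by decide
    rw [h1, h2, if_pos e1, mul_zero, neg_zero, chi_zero, C_1]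
    linear_combination X * hC
  · have h1 : (-(2 * 1) : ZMod 3) = 1 := by decide
    have h2 : (-(2 * 2) : ZMod 3) = 2 := by decide
    rw [h1, h2, if_pos e2, mul_zero, neg_zero, chi_zero, C_1]
    linear_combination X * hC

open Polynomial in
theorem sum_chi_neg_dotp_mul_X_pow {m : ℕ} (w : Fin m → ZMod 3) :
    ∑ x : Fin m → ZMod 3, C (chi (-dotp w x)) * X ^ hammingNorm x
      = (1 - X : ℂ[X]) ^ hammingNorm w * (1 + 2 * X) ^ (m - hammingNorm w) := by
  have hterm (x : Fin m → ZMod 3) :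
      C (chi (-dotp w x)) * X ^ hammingNorm x
        = ∏ i, (C (chi (-(w i * x i))) * X ^ (if x i ≠ 0 then 1 else 0) : ℂ[X]) := by
    rw [Finset.prod_mul_distrib, Finset.prod_pow_eq_pow_sum, ← map_prod, ← chi_sum,
      dotp, Finset.sum_neg_distrib, hammingNorm, Finset.card_filter]
  have hcard : (Finset.univ.filter fun i => ¬ w i ≠ 0).card = m - hammingNorm w := by
    have h := Finset.card_filter_add_card_filter_not (s := Finset.univ) (fun i => w i ≠ 0)
    rw [Finset.card_univ, Fintype.card_fin] at h
    rw [hammingNorm]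
    omega
  rw [Finset.sum_congr rfl fun x _ => hterm x,
    ← Fintype.prod_sum fun i a => (C (chi (-(w i * a))) * X ^ (if a ≠ 0 then 1 else 0) : ℂ[X]),
    Finset.prod_congr rfl fun i _ => sum_chi_mul_X_pow (w i),
    Finset.prod_ite, Finset.prod_const, Finset.prod_const, hcard, hammingNorm]

theorem hammingNorm_le {m : ℕ} (x : Fin m → ZMod 3) : hammingNorm x ≤ m := by
  simpa using hammingNorm_le_card_fintype (x := x)

open Polynomial in
/-- The character sum over a Hamming sphere is a Krawtchouk number. -/
theorem sum_chi_neg_dotp_sphere {m : ℕ} (w : Fin m → ZMod 3) (t : ℕ) :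
    ∑ x : Fin m → ZMod 3 with hammingNorm x = t, chi (-dotp w x)
      = (Kraw t (hammingNorm w) m : ℂ) := by
  have h := congrArg (fun p => coeff p t) (sum_chi_neg_dotp_mul_X_pow w)
  have hmap : (1 - X : ℂ[X]) ^ hammingNorm w * (1 + 2 * X) ^ (m - hammingNorm w)
      = ((1 - X : ℤ[X]) ^ hammingNorm w * (1 + 2 * X) ^ (m - hammingNorm w)).map
        (Int.castRingHom ℂ) := by
    simp
  simp only [hmap, coeff_map, coeff_one_sub_X_pow_mul, finsetSum_coeff, coeff_C_mul,
    coeff_X_pow] at h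
  rw [Nat.add_sub_cancel' (hammingNorm_le w)] at h
  rw [Finset.sum_filter]
  simpa [eq_comm] using h

theorem walsh_re_of_weight {m : ℕ} (φ : ℕ → ZMod 3) (w : Fin m → ZMod 3) :
    (walsh (fun x => φ (hammingNorm x)) w).re
      = (if hammingNorm w = 0 then 3 ^ m else 0)
        - 3 / 2 * ∑ t ∈ (Finset.range (m + 1)).filter (fun t => φ t ≠ 0),
          (Kraw t (hammingNorm w) m : ℝ) := by
  have h : walsh (fun x => φ (hammingNorm x)) w
      = ∑ t ∈ Finset.range (m + 1), chi (φ t) * ((Kraw t (hammingNorm w) m : ℝ) : ℂ) := by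
    rw [walsh, ← Finset.sum_fiberwise_of_maps_to (g := hammingNorm)
      (t := Finset.range (m + 1))
      fun x _ => Finset.mem_range.2 (Nat.lt_succ_of_le (hammingNorm_le x))]
    refine Finset.sum_congr rfl fun t _ => ?_
    rw [Complex.ofReal_intCast, ← sum_chi_neg_dotp_sphere, Finset.mul_sum]
    refine Finset.sum_congr rfl fun x hx => ?_
    rw [(Finset.mem_filter.1 hx).2, sub_eq_add_neg, chi_add]
  have hK := congrArg (Int.cast : ℤ → ℝ) (sum_range_Kraw (hammingNorm_le w))
  push_cast at hK
  rw [h, Complex.re_sum, ← hK, Finset.mul_sum, Finset.sum_filter, ← Finset.sum_sub_distrib]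
  refine Finset.sum_congr rfl fun t _ => ?_
  rw [Complex.re_mul_ofReal, chi_re]
  by_cases ht : φ t = 0
  · simp [ht]
  · simp only [ht, if_false, ne_eq, not_false_eq_true, if_true]
    ring

/-- The value of `ffun - gfun` on vectors of weight `t`. -/
def subWeight (k₁ k₂ t : ℕ) : ZMod 3 :=
  (if 1 ≤ t ∧ t ≤ k₂ ∧ t ≠ k₁ then 1 else 0)
    - (if k₁ ≤ t ∧ t ≤ k₂ - 1 then 1 else if t = k₂ then -1 else 0)

theorem subWeight_ne_zero_iff {k₁ k₂ : ℕ} (hk₁ : 1 ≤ k₁) (hk : k₁ < k₂) (t : ℕ) :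
    subWeight k₁ k₂ t ≠ 0 ↔ (1 ≤ t ∧ t ≤ k₁) ∨ t = k₂ := by
  have h1 : (1 - 0 : ZMod 3) ≠ 0 := by decide
  have h2 : (0 - 1 : ZMod 3) ≠ 0 := by decide
  have h3 : (1 - -1 : ZMod 3) ≠ 0 := by decide
  unfold subWeight
  split_ifs <;> simp only [h1, h2, h3, sub_self, ne_eq, not_true_eq_false, not_false_eq_true,
    true_iff, false_iff] <;> omega

theorem walsh_ffun_sub_gfun_re {m k₁ k₂ : ℕ} (hk₁ : 1 ≤ k₁) (hk : k₁ < k₂) (hk₂ : k₂ ≤ m)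
    (w : Fin m → ZMod 3) :
    (walsh (ffun m k₁ k₂ - gfun m k₁ k₂) w).re
      = (if hammingNorm w = 0 then 3 ^ m else 0)
        - 3 / 2 * (∑ t ∈ Finset.Icc 1 k₁, (Kraw t (hammingNorm w) m : ℝ)
          + Kraw k₂ (hammingNorm w) m) := by
  have hfilter : (Finset.range (m + 1)).filter (fun t => subWeight k₁ k₂ t ≠ 0)
      = insert k₂ (Finset.Icc 1 k₁) := by
    ext t
    simp only [Finset.mem_filter, Finset.mem_range, Finset.mem_insert, Finset.mem_Icc,
      subWeight_ne_zero_iff hk₁ hk]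
    omega
  have hnot : k₂ ∉ Finset.Icc 1 k₁ := by simp; omega
  have h := walsh_re_of_weight (subWeight k₁ k₂) w
  rw [hfilter, Finset.sum_insert hnot, add_comm (Kraw k₂ _ m : ℝ)] at h
  exact h

theorem Lloyd_eq_one_add_sum_Icc (k i m : ℕ) :
    Lloyd k i m = 1 + ∑ t ∈ Finset.Icc 1 k, Kraw t i m := by
  rw [Lloyd, Finset.sum_range_succ', Kraw_zero_left, add_comm,
    Finset.range_eq_Ico, Finset.sum_Ico_add' (fun t => Kraw t i m)]
  rfl

theorem Lloyd_succ (k i m : ℕ) : Lloyd (k + 1) i m = Lloyd k i m + Kraw (k + 1) i m :=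
  Finset.sum_range_succ _ _

theorem stmt6 (m k₁ k₂ : ℕ) (hm : 9 ≤ m) (hk₁ : 2 ≤ k₁) (hk : k₁ + 1 < k₂)
    (hk₂ : k₂ ≤ (m - 1) / 2) :
    (walsh (ffun m k₁ k₂ - gfun m k₁ k₂) (0 : Fin m → ZMod 3)).re
      = 3 ^ m - 3 / 2 * ((∑ j ∈ Finset.Icc 1 k₁, (2 : ℝ) ^ j * (m.choose j : ℝ))
          + 2 ^ k₂ * (m.choose k₂ : ℝ)) ∧
    ∀ (w : Fin m → ZMod 3) (i : ℕ), hammingNorm w = i → 1 ≤ i →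
      (walsh (ffun m k₁ k₂ - gfun m k₁ k₂) w).re
        = -(3 / 2) * ((Lloyd k₂ i m : ℝ) + (Lloyd k₁ i m : ℝ)
            - (Lloyd (k₂ - 1) i m : ℝ)) + 3 / 2 := by
  have hwalsh := walsh_ffun_sub_gfun_re (m := m) (by omega : 1 ≤ k₁) (by omega : k₁ < k₂)
    (by omega)
  refine ⟨?_, ?_⟩
  · rw [hwalsh, hammingNorm_zero, if_pos rfl]
    simp [Kraw_zero_middle]
  · rintro w i rfl hi
    obtain ⟨k, rfl⟩ := Nat.exists_eq_add_of_le' (by omega : 1 ≤ k₂)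
    rw [hwalsh, if_neg (by omega), Nat.add_sub_cancel, Lloyd_succ, Lloyd_eq_one_add_sum_Icc k₁]
    push_cast
    ring
end

section
/- Let m, k₁, k₂ be integers with m ≥ 9 and 2 ≤ k₁ < k₁ + 1 < k₂ ≤ ⌊(m−1)/2⌋, let f be the characteristic-type function defined from the weight classes A, C, D, and let v ∈ F₃^m with Hamming weight wt(v) = i ≥ 1. Set α = Ψ_{k₁−1}(i,m) − 1, γ = Ψ_{k₂−1}(i,m) − Ψ_{k₁}(i,m), δ = Ψ_{k₂}(i,m) − Ψ_{k₂−1}(i,m). Then the number of nonzero x ∈ F₃^m with f(x) + v·x = 0 equals 3^{m−1} − 1 − (α + γ + δ); the number with f(x) + v·x = 1 equals 3^{m−1} + α + γ + δ; and the number with f(x) + v·x = 2 equals 3^{m−1}. -/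
open Finset

theorem sum_univ_zmod_three {M : Type*} [AddCommMonoid M] (F : ZMod 3 → M) :
    ∑ a, F a = F 0 + F 1 + F 2 :=
  Fin.sum_univ_three F

open Polynomial in
theorem coeff_one_add_C_mul_X_pow {R : Type*} [CommSemiring R] (c : R) (n t : ℕ) :
    ((1 + C c * X : R[X]) ^ n).coeff t = c ^ t * (n.choose t : R) := by
  have h : (1 + C c * X : R[X]) ^ n = ((1 + X) ^ n : R[X]).comp (C c * X) := by simp
  rw [h, comp_C_mul_X_coeff, coeff_one_add_X_pow, mul_comm]

open Polynomial in
theorem Kraw_eq_coeff (t x m : ℕ) :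
    (Kraw t x m : ℂ) = ((1 - X : ℂ[X]) ^ x * (1 + 2 * X) ^ (m - x)).coeff t := by
  have h₁ : (1 - X : ℂ[X]) = 1 + C (-1) * X := by simp [sub_eq_add_neg]
  have h₂ : (1 + 2 * X : ℂ[X]) = 1 + C 2 * X := rfl
  rw [h₁, h₂, coeff_mul, Finset.Nat.sum_antidiagonal_eq_sum_range_succ_mk]
  simp only [coeff_one_add_C_mul_X_pow, Kraw]
  push_cast
  refine Finset.sum_congr rfl fun j _ => ?_
  ring

theorem one_add_stdAddChar_add_stdAddChar :
    (1 : ℂ) + ZMod.stdAddChar (1 : ZMod 3) + ZMod.stdAddChar (2 : ZMod 3) = 0 := by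
  have h : ∑ a : ZMod 3, (ZMod.stdAddChar a : ℂ) = 0 := by
    refine AddChar.sum_eq_zero_of_ne_one fun h => ?_
    have h1 := ZMod.injective_stdAddChar (N := 3) (a₁ := 1) (a₂ := 0) (by simp [h])
    exact absurd h1 (by decide)
  rwa [sum_univ_zmod_three, AddChar.map_zero_eq_one] at h

open Polynomial in
theorem sum_stdAddChar_mul_X_pow (a : ZMod 3) :
    ∑ b : ZMod 3, (C (ZMod.stdAddChar (a * b) : ℂ) * if b ≠ 0 then X else 1) =
      if a ≠ 0 then (1 - X : ℂ[X]) else 1 + 2 * X := by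
  have hC : (1 : ℂ[X]) + C (ZMod.stdAddChar (1 : ZMod 3)) + C (ZMod.stdAddChar (2 : ZMod 3))
      = 0 := by
    rw [← C_1, ← C_add, ← C_add, one_add_stdAddChar_add_stdAddChar, C_0]
  rw [sum_univ_zmod_three]
  rw [if_neg (by decide), if_pos (by decide), if_pos (by decide)]
  have ha : a = 0 ∨ a = 1 ∨ a = 2 := by revert a; decide
  rcases ha with rfl | rfl | rfl
  · simp
    ring
  · rw [if_pos (by decide)]
    simp only [mul_zero, one_mul, AddChar.map_zero_eq_one, C_1]
    linear_combination X * hC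
  · rw [if_pos (by decide), show (2 * 2 : ZMod 3) = 1 by decide]
    simp only [mul_zero, mul_one, AddChar.map_zero_eq_one, C_1]
    linear_combination X * hC

open Polynomial in
/-- The weight enumerator of `F₃^m` twisted by the character `x ↦ ζ₃^(v·x)`. -/
theorem sum_stdAddChar_dotp_mul_X_pow {m : ℕ} (v : Fin m → ZMod 3) :
    ∑ x : Fin m → ZMod 3, C (ZMod.stdAddChar (dotp v x) : ℂ) * X ^ hammingNorm x =
      (1 - X) ^ hammingNorm v * (1 + 2 * X) ^ (m - hammingNorm v) := by
  have hx : ∀ x : Fin m → ZMod 3,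
      (C (ZMod.stdAddChar (dotp v x) : ℂ) * X ^ hammingNorm x : ℂ[X]) =
        ∏ j, (C (ZMod.stdAddChar (v j * x j) : ℂ) * if x j ≠ 0 then X else 1) := by
    intro x
    rw [Finset.prod_mul_distrib, ← map_prod, Finset.prod_ite, Finset.prod_const,
      Finset.prod_const_one, mul_one]
    congr 2
    exact map_prod (ZMod.stdAddChar (N := 3)).toMonoidHom
      (fun j => Multiplicative.ofAdd (v j * x j)) univ
  have hcard : (univ.filter fun j => ¬ v j ≠ 0).card = m - hammingNorm v := by
    have h := Finset.card_filter_add_card_filter_not (s := univ) (fun j => v j ≠ 0)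
    rw [Finset.card_univ, Fintype.card_fin] at h
    rw [hammingNorm]
    lia
  rw [Finset.sum_congr rfl fun x _ => hx x, ← Fintype.piFinset_univ,
    ← Finset.prod_univ_sum (fun _ => univ)
      (fun j b => (C (ZMod.stdAddChar (v j * b) : ℂ) * if b ≠ 0 then X else 1))]
  simp only [sum_stdAddChar_mul_X_pow]
  rw [Finset.prod_ite, Finset.prod_const, Finset.prod_const, hcard]
  rfl

theorem sum_stdAddChar_dotp_of_hammingNorm_eq {m : ℕ} (v : Fin m → ZMod 3) (t : ℕ) :
    ∑ x : Fin m → ZMod 3 with hammingNorm x = t, (ZMod.stdAddChar (dotp v x) : ℂ) =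
      Kraw t (hammingNorm v) m := by
  rw [Kraw_eq_coeff, ← sum_stdAddChar_dotp_mul_X_pow, Polynomial.finsetSum_coeff,
    Finset.sum_filter]
  simp [Polynomial.coeff_C_mul, Polynomial.coeff_X_pow, eq_comm]

theorem dotp_neg {m : ℕ} (v x : Fin m → ZMod 3) : dotp v (-x) = -dotp v x := by
  simp [dotp]

theorem hammingNorm_neg {m : ℕ} (x : Fin m → ZMod 3) : hammingNorm (-x) = hammingNorm x := by
  simp [hammingNorm]

/-- On a set of vectors stable under negation the values `1` and `2` of `v·x` are equally
frequent. -/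
theorem card_dotp_eq_two {m : ℕ} (v : Fin m → ZMod 3) (P : (Fin m → ZMod 3) → Prop)
    [DecidablePred P] (hP : ∀ x, P (-x) ↔ P x) :
    (univ.filter fun x => P x ∧ dotp v x = 2).card =
      (univ.filter fun x => P x ∧ dotp v x = 1).card := by
  refine Finset.card_bij' (fun x _ => -x) (fun x _ => -x) ?_ ?_ ?_ ?_
  · intro x hx
    simp only [mem_filter, mem_univ, true_and, hP, dotp_neg] at hx ⊢
    exact ⟨hx.1, by rw [hx.2]; decide⟩
  · intro x hx
    simp only [mem_filter, mem_univ, true_and, hP, dotp_neg] at hx ⊢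
    exact ⟨hx.1, by rw [hx.2]; decide⟩
  · simp
  · simp

theorem sum_zmod_comp {m : ℕ} {M : Type*} [AddCommMonoid M] (v : Fin m → ZMod 3)
    (P : (Fin m → ZMod 3) → Prop) [DecidablePred P] (F : ZMod 3 → M) :
    ∑ x with P x, F (dotp v x) =
      (univ.filter fun x => P x ∧ dotp v x = 0).card • F 0 +
      (univ.filter fun x => P x ∧ dotp v x = 1).card • F 1 +
      (univ.filter fun x => P x ∧ dotp v x = 2).card • F 2 := by
  rw [← Finset.sum_fiberwise (univ.filter P) (dotp v)]
  have h : ∀ a : ZMod 3, ∑ x ∈ univ.filter P with dotp v x = a, F (dotp v x) =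
      (univ.filter fun x => P x ∧ dotp v x = a).card • F a := by
    intro a
    rw [Finset.filter_filter, ← Finset.sum_const]
    exact Finset.sum_congr rfl fun x hx => by rw [(mem_filter.1 hx).2.2]
  simp only [h]
  exact sum_univ_zmod_three _

/-- A character sum over a set stable under negation is a difference of two fibre sizes. -/
theorem sum_stdAddChar_dotp {m : ℕ} (v : Fin m → ZMod 3) (P : (Fin m → ZMod 3) → Prop)
    [DecidablePred P] (hP : ∀ x, P (-x) ↔ P x) :
    ∑ x with P x, (ZMod.stdAddChar (dotp v x) : ℂ) =
      (univ.filter fun x => P x ∧ dotp v x = 0).card -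
      (univ.filter fun x => P x ∧ dotp v x = 1).card := by
  rw [sum_zmod_comp v P (fun a => (ZMod.stdAddChar a : ℂ)), card_dotp_eq_two v P hP]
  simp only [nsmul_eq_mul, AddChar.map_zero_eq_one]
  linear_combination ((univ.filter fun x => P x ∧ dotp v x = 1).card : ℂ) *
    one_add_stdAddChar_add_stdAddChar

theorem card_dotp_eq {m : ℕ} {v : Fin m → ZMod 3} (hv : 1 ≤ hammingNorm v) :
    (univ.filter fun x => dotp v x = 0).card = 3 ^ (m - 1) ∧
    (univ.filter fun x => dotp v x = 1).card = 3 ^ (m - 1) ∧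
    (univ.filter fun x => dotp v x = 2).card = 3 ^ (m - 1) := by
  have hsum : ∑ x : Fin m → ZMod 3, (ZMod.stdAddChar (dotp v x) : ℂ) = 0 := by
    have h := congrArg (Polynomial.eval 1) (sum_stdAddChar_dotp_mul_X_pow v)
    simpa [Polynomial.eval_finsetSum, zero_pow (Nat.one_le_iff_ne_zero.1 hv)] using h
  have h12 := card_dotp_eq_two v (fun _ => True) (by simp)
  have h01 := sum_stdAddChar_dotp v (fun _ => True) (by simp)
  have hall := sum_zmod_comp v (fun _ => True) (fun _ => 1)
  simp only [true_and, Finset.filter_true, hsum] at h12 h01 hall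
  have h01' : (univ.filter fun x => dotp v x = 0).card =
      (univ.filter fun x => dotp v x = 1).card := by
    exact_mod_cast (sub_eq_zero.1 h01.symm)
  have hm : hammingNorm v ≤ m := by simpa using hammingNorm_le_card_fintype (x := v)
  have hpow : 3 ^ m = 3 * 3 ^ (m - 1) := by
    rw [← pow_succ']
    congr 1
    lia
  simp [ZMod.card] at hall
  lia

/-- The fibre-size difference over a union of weight classes is a sum of Krawtchouk values. -/
theorem card_sub_card_eq_sum_Kraw {m : ℕ} (v : Fin m → ZMod 3) (T : Finset ℕ) :
    ((univ.filter fun x => hammingNorm x ∈ T ∧ dotp v x = 0).card : ℤ) -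
      (univ.filter fun x => hammingNorm x ∈ T ∧ dotp v x = 1).card =
      ∑ t ∈ T, Kraw t (hammingNorm v) m := by
  have h := sum_stdAddChar_dotp v (fun x => hammingNorm x ∈ T) (by simp [hammingNorm_neg])
  rw [← Finset.sum_fiberwise_of_maps_to (g := hammingNorm) (t := T)
    (fun x hx => (mem_filter.1 hx).2)] at h
  have h' : ∀ t ∈ T, ∑ x ∈ univ.filter (fun x : Fin m → ZMod 3 => hammingNorm x ∈ T) with
      hammingNorm x = t, (ZMod.stdAddChar (dotp v x) : ℂ) = Kraw t (hammingNorm v) m := by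
    intro t ht
    rw [← sum_stdAddChar_dotp_of_hammingNorm_eq, Finset.filter_filter]
    refine Finset.sum_congr (Finset.filter_congr fun x _ => ?_) fun _ _ => rfl
    exact ⟨fun hx => hx.2, fun hx => ⟨hx ▸ ht, hx⟩⟩
  rw [Finset.sum_congr rfl h'] at h
  exact_mod_cast h.symm

theorem Lloyd_pred_add_Kraw {k : ℕ} (hk : 1 ≤ k) (x m : ℕ) :
    Lloyd (k - 1) x m + Kraw k x m = Lloyd k x m := by
  rw [Lloyd, Lloyd, Nat.sub_add_cancel hk, Finset.sum_range_succ]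

theorem sum_Kraw_eq_Lloyd {k₁ k₂ : ℕ} (hk₁ : 1 ≤ k₁) (hk : k₁ ≤ k₂) (x m : ℕ) :
    ∑ t ∈ (Finset.Icc 1 k₂).erase k₁, Kraw t x m =
      Lloyd k₂ x m - 1 - (Lloyd k₁ x m - Lloyd (k₁ - 1) x m) := by
  have h1 := Finset.add_sum_erase (Finset.Icc 1 k₂) (fun t => Kraw t x m)
    (Finset.mem_Icc.2 ⟨hk₁, hk⟩)
  have h2 : Lloyd k₂ x m = Kraw 0 x m + ∑ t ∈ Finset.Icc 1 k₂, Kraw t x m := by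
    rw [Lloyd, Finset.range_eq_Ico, Finset.sum_eq_sum_Ico_succ_bot (Nat.succ_pos k₂)]
    rfl
  have h3 : Kraw 0 x m = 1 := by simp [Kraw]
  have h4 := Lloyd_pred_add_Kraw hk₁ x m
  linarith

/-- Shifting `v·x` by `1` on a set `P` exchanges fibres over `P` only. -/
theorem card_add_dotp_eq {m : ℕ} (v : Fin m → ZMod 3) (P : (Fin m → ZMod 3) → Prop)
    [DecidablePred P] (hP0 : ¬ P 0) (a b : ZMod 3) (hb : 1 + b = a) :
    (univ.filter fun x => x ≠ 0 ∧ (if P x then (1 : ZMod 3) else 0) + dotp v x = a).card +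
        (univ.filter fun x => P x ∧ dotp v x = a).card + (if a = 0 then 1 else 0) =
      (univ.filter fun x => dotp v x = a).card +
        (univ.filter fun x => P x ∧ dotp v x = b).card := by
  have h0 : (if a = 0 then 1 else 0) =
      ∑ x : Fin m → ZMod 3, if x = 0 then (if a = 0 then 1 else 0) else 0 := by simp
  rw [h0]
  simp only [Finset.card_filter, ← Finset.sum_add_distrib]
  refine Finset.sum_congr rfl fun x _ => ?_
  by_cases hx : x = 0
  · subst hx
    have : dotp v 0 = 0 := by simp [dotp]
    simp [hP0, this, eq_comm]
  · by_cases hp : P x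
    · subst hb
      simp [hx, hp]
      ring
    · simp [hx, hp]

theorem stmt8 (m k₁ k₂ : ℕ) (hm : 9 ≤ m) (hk₁ : 2 ≤ k₁) (hk : k₁ + 1 < k₂)
    (hk₂ : k₂ ≤ (m - 1) / 2)
    (v : Fin m → ZMod 3) (i : ℕ) (hi : hammingNorm v = i) (hi1 : 1 ≤ i) :
    ((Finset.univ.filter
        (fun x : Fin m → ZMod 3 => x ≠ 0 ∧ ffun m k₁ k₂ x + dotp v x = 0)).card : ℤ)
      = 3 ^ (m - 1) - 1 - ((Lloyd (k₁ - 1) i m - 1)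
          + (Lloyd (k₂ - 1) i m - Lloyd k₁ i m) + (Lloyd k₂ i m - Lloyd (k₂ - 1) i m)) ∧
    ((Finset.univ.filter
        (fun x : Fin m → ZMod 3 => x ≠ 0 ∧ ffun m k₁ k₂ x + dotp v x = 1)).card : ℤ)
      = 3 ^ (m - 1) + ((Lloyd (k₁ - 1) i m - 1)
          + (Lloyd (k₂ - 1) i m - Lloyd k₁ i m) + (Lloyd k₂ i m - Lloyd (k₂ - 1) i m)) ∧
    ((Finset.univ.filter
        (fun x : Fin m → ZMod 3 => x ≠ 0 ∧ ffun m k₁ k₂ x + dotp v x = 2)).card : ℤ)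
      = 3 ^ (m - 1) := by
  subst hi
  set T := (Finset.Icc 1 k₂).erase k₁ with hT
  have hf : ∀ x, ffun m k₁ k₂ x = if hammingNorm x ∈ T then 1 else 0 := by
    intro x
    simp only [ffun, hT, Finset.mem_erase, Finset.mem_Icc]
    congr 1
    exact propext (by tauto)
  have hP0 : ¬ hammingNorm (0 : Fin m → ZMod 3) ∈ T := by simp [hT]
  obtain ⟨hd0, hd1, hd2⟩ := card_dotp_eq hi1
  have h12 := card_dotp_eq_two v (fun x => hammingNorm x ∈ T) (by simp [hammingNorm_neg])
  have hK := card_sub_card_eq_sum_Kraw v T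
  rw [sum_Kraw_eq_Lloyd (by lia) (by lia)] at hK
  have e0 := card_add_dotp_eq v (fun x => hammingNorm x ∈ T) hP0 0 2 (by decide)
  have e1 := card_add_dotp_eq v (fun x => hammingNorm x ∈ T) hP0 1 0 (by decide)
  have e2 := card_add_dotp_eq v (fun x => hammingNorm x ∈ T) hP0 2 1 (by decide)
  rw [if_pos rfl, hd0, h12] at e0
  rw [if_neg (by decide), hd1] at e1
  rw [if_neg (by decide), hd2, h12] at e2
  simp only [hf]
  zify at e0 e1 e2
  refine ⟨?_, ?_, ?_⟩ <;> linarith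
end
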